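/- Let X be a p-smooth and 2-convex Banach space with 1 < p < 2, let R(u) = (1/p)‖u‖^p_X and q = p/(p−1). Assume the approximate source conditions: there are C > 0 and β0 > 0 with inf_{w∈Y}[ (1/β)‖K*w − μ†‖^q_{X*} + ½‖w‖²_Y ] ≤ C β^{−r1} and inf_{w∈Y}[ (1/β)‖K*w − η‖^q_{X*} + ½‖w‖²_Y ] ≤ C β^{−r2} for all 0 < β ≤ β0, with r1, r2 ≥ 0 and r1 < 1. Set ν_i = 2 + r_i(q−2) and choose α = α(δ) with c δ^κ ≤ α(δ) ≤ C' δ^κ, where κ = ν1ν2/(ν1ν2 + q(r2−r1)) if r1 ≤ r2 and κ = 1 if r2 < r1 < 1. Then there exist C_p > 0 and δ0 > 0 such that for all δ ∈ (0, δ0], D(u^δ_α, u†) ≤ C_p δ^{2ν2(1−r1)/(ν1ν2 + q(r2−r1))} when r1 ≤ r2, and D(u^δ_α, u†) ≤ C_p δ^{2(1−r1)/(2 + r1(q−2))} when r2 < r1 < 1. -/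

import Mathlib

open scoped RealInnerProductSpace

/-- A subgradient of `(1/p)‖·‖^p` at `u` satisfies `μ u = ‖u‖^p`. -/
lemma subgradient_apply_self {X : Type*} [NormedAddCommGroup X] [NormedSpace ℝ X]
    {p : ℝ} (hp : 1 < p) {u : X} {μ : X →L[ℝ] ℝ}
    (h : ∀ v : X, 1 / p * ‖u‖ ^ p + μ (v - u) ≤ 1 / p * ‖v‖ ^ p) :
    μ u = ‖u‖ ^ p := by
  have hp0 : p ≠ 0 := by linarith
  have hderiv : HasDerivAt (fun t : ℝ => 1 / p * ‖u‖ ^ p * |t| ^ p - (t - 1) * μ u)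
      (1 / p * ‖u‖ ^ p * (p * |(1 : ℝ)| ^ (p - 2) * 1) - 1 * μ u) 1 :=
    ((hasDerivAt_abs_rpow 1 hp).const_mul _).sub
      (((hasDerivAt_id (1 : ℝ)).sub_const 1).mul_const (μ u))
  have hmin : IsLocalMin (fun t : ℝ => 1 / p * ‖u‖ ^ p * |t| ^ p - (t - 1) * μ u) 1 := by
    refine Filter.Eventually.of_forall fun t => ?_
    have ht := h (t • u)
    have hlin : μ (t • u - u) = (t - 1) * μ u := by simp; ring
    rw [hlin, norm_smul, Real.norm_eq_abs, Real.mul_rpow (abs_nonneg _) (norm_nonneg _)] at ht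
    simp only [abs_one, Real.one_rpow, sub_self, zero_mul]
    linarith
  have hzero := hmin.hasDerivAt_eq_zero hderiv
  simp only [abs_one, Real.one_rpow, mul_one, one_mul] at hzero
  field_simp at hzero
  linarith

/-- A subgradient of `(1/p)‖·‖^p` at `u` has norm `‖u‖^(p-1)`. -/
lemma norm_subgradient {X : Type*} [NormedAddCommGroup X] [NormedSpace ℝ X]
    {p : ℝ} (hp : 1 < p) {u : X} {μ : X →L[ℝ] ℝ}
    (h : ∀ v : X, 1 / p * ‖u‖ ^ p + μ (v - u) ≤ 1 / p * ‖v‖ ^ p) :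
    ‖μ‖ = ‖u‖ ^ (p - 1) := by
  have hp0 : p ≠ 0 := by linarith
  have hself := subgradient_apply_self hp h
  rcases (norm_nonneg u).eq_or_lt with hu | hu
  · have hu0 : u = 0 := norm_eq_zero.mp hu.symm
    subst hu0
    rw [norm_zero, Real.zero_rpow (by linarith), norm_eq_zero]
    ext w
    have hderiv : HasDerivAt (fun t : ℝ => 1 / p * ‖w‖ ^ p * |t| ^ p - t * μ w)
        (1 / p * ‖w‖ ^ p * (p * |(0 : ℝ)| ^ (p - 2) * 0) - 1 * μ w) 0 :=
      ((hasDerivAt_abs_rpow 0 hp).const_mul _).sub ((hasDerivAt_id (0 : ℝ)).mul_const (μ w))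
    have hmin : IsLocalMin (fun t : ℝ => 1 / p * ‖w‖ ^ p * |t| ^ p - t * μ w) 0 := by
      refine Filter.Eventually.of_forall fun t => ?_
      have ht := h (t • w)
      rw [norm_smul, Real.norm_eq_abs, Real.mul_rpow (abs_nonneg _) (norm_nonneg _)] at ht
      simp only [norm_zero, Real.zero_rpow hp0, sub_zero, map_smul, smul_eq_mul] at ht
      simp only [abs_zero, Real.zero_rpow hp0, zero_mul]
      linarith
    have hzero := hmin.hasDerivAt_eq_zero hderiv
    simpa using hzero
  · have hpow : ‖u‖ ^ p = ‖u‖ ^ (p - 1) * ‖u‖ := by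
      rw [← Real.rpow_add_one hu.ne']; simp
    have hle : ∀ w : X, μ w ≤ ‖u‖ ^ (p - 1) * ‖w‖ := by
      intro w
      rcases (norm_nonneg w).eq_or_lt with hw | hw
      · have hw0 : w = 0 := norm_eq_zero.mp hw.symm
        simp [hw0]
      · have ht := h ((‖u‖ / ‖w‖) • w)
        have hnorm : ‖(‖u‖ / ‖w‖) • w‖ = ‖u‖ := by
          rw [norm_smul, Real.norm_of_nonneg (by positivity)]
          field_simp
        rw [hnorm, map_sub, map_smul, smul_eq_mul, hself, hpow] at ht
        have h2 : ‖u‖ / ‖w‖ * μ w ≤ ‖u‖ ^ (p - 1) * ‖u‖ := by linarith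
        rw [div_mul_eq_mul_div, div_le_iff₀ hw] at h2
        nlinarith
    apply le_antisymm
    · refine μ.opNorm_le_bound (by positivity) fun w => ?_
      rw [Real.norm_eq_abs, abs_le]
      have := hle (-w)
      rw [map_neg, norm_neg] at this
      exact ⟨by linarith, hle w⟩
    · have := (le_abs_self _).trans (μ.le_opNorm u)
      rw [hself, hpow] at this
      exact le_of_mul_le_mul_right this hu

/-- The lower Bregman-distance estimate in a `2`-convex space, for `‖v‖ ≤ ‖u‖`. -/
lemma sq_norm_sub_le_bregman_of_norm_le {X : Type*} [NormedAddCommGroup X] [NormedSpace ℝ X]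
    {p c : ℝ} (hp1 : 1 < p) (hp2 : p < 2)
    (hconvex : ∀ (u v : X) (j2 : X →L[ℝ] ℝ), j2 u = ‖u‖ * ‖j2‖ → ‖j2‖ = ‖u‖ →
      1 / 2 * ‖u‖ ^ 2 - j2 v + c / 2 * ‖v‖ ^ 2 ≤ 1 / 2 * ‖u - v‖ ^ 2)
    {u v : X} {μ ν : X →L[ℝ] ℝ}
    (hμ : ∀ w : X, 1 / p * ‖u‖ ^ p + μ (w - u) ≤ 1 / p * ‖w‖ ^ p)
    (hν : ∀ w : X, 1 / p * ‖v‖ ^ p + ν (w - v) ≤ 1 / p * ‖w‖ ^ p)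
    (huv : ‖v‖ ≤ ‖u‖) :
    (p - 1) * c * ‖u - v‖ ^ 2 ≤ (2 * p - 1) * (‖u‖ ^ (2 - p) * (μ - ν) (u - v)) := by
  rcases (norm_nonneg u).eq_or_lt with hu | hu
  · have hu0 : u = 0 := norm_eq_zero.mp hu.symm
    have hv0 : v = 0 := norm_eq_zero.mp (le_antisymm (huv.trans hu.symm.le) (norm_nonneg v))
    simp [hu0, hv0]
  have hμu := subgradient_apply_self hp1 hμ
  have hνv := subgradient_apply_self hp1 hν
  have hμn := norm_subgradient hp1 hμ
  have hνn := norm_subgradient hp1 hν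
  set a := ‖u‖ with ha
  set b := ‖v‖ with hb
  have hb0 : 0 ≤ b := norm_nonneg v
  set A := a ^ (2 - p) with hA
  have hA0 : 0 < A := by positivity
  have hAa : A * a ^ (p - 1) = a := by
    rw [hA, ← Real.rpow_add hu]; norm_num
  have hap : a ^ p = a ^ (p - 1) * a := by
    rw [← Real.rpow_add_one hu.ne']; simp
  have hbp : b ^ p = b ^ (p - 1) * b := by
    rcases hb0.eq_or_lt with h | h
    · rw [← h, Real.zero_rpow (by linarith)]; simp
    · rw [← Real.rpow_add_one h.ne']; simp
  set B := A * b ^ (p - 1) with hB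
  have hBa : B ≤ a + (p - 1) * (b - a) := by
    have hbern := rpow_one_add_le_one_add_mul_self (s := b / a - 1)
      (by have : 0 ≤ b / a := by positivity
          linarith) (p := p - 1) (by linarith) (by linarith)
    have h1 : (1 + (b / a - 1)) ^ (p - 1) = b ^ (p - 1) / a ^ (p - 1) := by
      rw [← Real.div_rpow hb0 hu.le]; congr 1; ring
    rw [h1, div_le_iff₀ (by positivity)] at hbern
    calc B ≤ A * ((1 + (p - 1) * (b / a - 1)) * a ^ (p - 1)) := by
          rw [hB]; gcongr
      _ = (1 + (p - 1) * (b / a - 1)) * (A * a ^ (p - 1)) := by ring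
      _ = a + (p - 1) * (b - a) := by rw [hAa]; field_simp
  have hμv : A * μ v ≤ a * b := by
    have h1 : μ v ≤ a ^ (p - 1) * b := by
      have := (le_abs_self _).trans (μ.le_opNorm v)
      rwa [hμn] at this
    calc A * μ v ≤ A * (a ^ (p - 1) * b) := by gcongr
      _ = a * b := by rw [← mul_assoc, hAa]
  have hνu : A * ν u ≤ B * a := by
    have h1 : ν u ≤ b ^ (p - 1) * a := by
      have := (le_abs_self _).trans (ν.le_opNorm u)
      rwa [hνn] at this
    calc A * ν u ≤ A * (b ^ (p - 1) * a) := by gcongr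
      _ = B * a := by rw [hB]; ring
  have hAμu : A * μ u = a * a := by rw [hμu, hap, ← mul_assoc, hAa]
  have hAνv : A * ν v = B * b := by rw [hνv, hbp, hB]; ring
  have hn : ‖A • μ‖ = a := by
    rw [norm_smul, Real.norm_of_nonneg hA0.le, hμn, hAa]
  have hconv := hconvex u (u - v) (A • μ)
    (by rw [hn]; simpa using hAμu) hn
  have hlin : (A • μ) (u - v) = a * a - A * μ v := by
    simp [mul_sub, hAμu]
  rw [hlin, sub_sub_cancel] at hconv
  have hD : A * (μ - ν) (u - v) = a * a + B * b - A * μ v - A * ν u := by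
    rw [← hAμu, ← hAνv]; simp; ring
  rw [hD]
  set d := ‖u - v‖
  have hab : 0 ≤ a - b := by linarith
  have hBa' : B ≤ a := by
    have := mul_nonneg (by linarith : 0 ≤ p - 1) hab
    linarith
  have e1 : (p - 1) * (a - b) ^ 2 ≤ a * a + B * b - A * μ v - A * ν u := by
    have := mul_le_mul_of_nonneg_right hBa hab
    linarith
  have e2 : c / 2 * d ^ 2 - 1 / 2 * (a - b) ^ 2 ≤ a * a + B * b - A * μ v - A * ν u := by
    have := mul_le_mul_of_nonneg_right hBa' hab
    linarith
  have e3 := mul_le_mul_of_nonneg_left e2 (by linarith : 0 ≤ 2 * (p - 1))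
  linarith

/-- Subgradients of `(1/p)‖·‖^p` are monotone. -/
lemma bregman_nonneg {X : Type*} [NormedAddCommGroup X] [NormedSpace ℝ X]
    {p : ℝ} {u v : X} {μ ν : X →L[ℝ] ℝ}
    (hμ : ∀ w : X, 1 / p * ‖u‖ ^ p + μ (w - u) ≤ 1 / p * ‖w‖ ^ p)
    (hν : ∀ w : X, 1 / p * ‖v‖ ^ p + ν (w - v) ≤ 1 / p * ‖w‖ ^ p) :
    0 ≤ (μ - ν) (u - v) := by
  have h1 := hμ v
  have h2 := hν u
  simp only [map_sub, sub_apply] at *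
  linarith

/-- The lower Bregman-distance estimate in a `2`-convex space. -/
lemma sq_norm_sub_le_bregman {X : Type*} [NormedAddCommGroup X] [NormedSpace ℝ X]
    {p c : ℝ} (hp1 : 1 < p) (hp2 : p < 2)
    (hconvex : ∀ (u v : X) (j2 : X →L[ℝ] ℝ), j2 u = ‖u‖ * ‖j2‖ → ‖j2‖ = ‖u‖ →
      1 / 2 * ‖u‖ ^ 2 - j2 v + c / 2 * ‖v‖ ^ 2 ≤ 1 / 2 * ‖u - v‖ ^ 2)
    {u v : X} {μ ν : X →L[ℝ] ℝ}
    (hμ : ∀ w : X, 1 / p * ‖u‖ ^ p + μ (w - u) ≤ 1 / p * ‖w‖ ^ p)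
    (hν : ∀ w : X, 1 / p * ‖v‖ ^ p + ν (w - v) ≤ 1 / p * ‖w‖ ^ p) :
    (p - 1) * c * ‖u - v‖ ^ 2
      ≤ (2 * p - 1) * ((‖u - v‖ + ‖v‖) ^ (2 - p) * (μ - ν) (u - v)) := by
  have hD := bregman_nonneg hμ hν
  have hp : 0 ≤ 2 * p - 1 := by linarith
  have hp' : 0 ≤ 2 - p := by linarith
  rcases le_total ‖v‖ ‖u‖ with h | h
  · refine (sq_norm_sub_le_bregman_of_norm_le hp1 hp2 hconvex hμ hν h).trans ?_
    have : ‖u‖ ≤ ‖u - v‖ + ‖v‖ := by simpa using norm_add_le (u - v) v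
    gcongr
  · have hswap := sq_norm_sub_le_bregman_of_norm_le hp1 hp2 hconvex hν hμ h
    have hneg : (ν - μ) (v - u) = (μ - ν) (u - v) := by simp; ring
    rw [hneg, norm_sub_rev] at hswap
    refine hswap.trans ?_
    have : ‖v‖ ≤ ‖u - v‖ + ‖v‖ := by linarith [norm_nonneg (u - v)]
    gcongr

/-- Absorption: a linear upper bound for `D` in `d` and the growth condition
`d² ≲ (d + L)^(2-p) D` give `D ≲ ρ²`. -/
lemma exists_bound_of_growth {p k L M₁ M₂ : ℝ} (hp1 : 1 < p) (hp2 : p < 2) (hk : 0 < k)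
    (hL : 0 ≤ L) (hM₁ : 0 < M₁) (hM₂ : 0 < M₂) :
    ∃ Cp : ℝ, 0 < Cp ∧ ∀ D d ρ : ℝ, 0 ≤ D → 0 ≤ d → 0 < ρ → ρ ≤ 1 →
      d ^ 2 ≤ k * ((d + L) ^ (2 - p) * D) → D ≤ M₁ * ρ ^ 2 + M₂ * ρ * d →
      D ≤ Cp * ρ ^ 2 := by
  set S := 2 * k * (M₁ + M₂) + 2 * (L + 1) ^ 2 with hS
  have hS0 : 0 < S := by positivity
  set T := S ^ (1 / (p - 1)) with hT
  have hT0 : 0 < T := by positivity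
  set k' := k * T ^ (2 - p) with hk'
  have hk'0 : 0 < k' := by positivity
  refine ⟨2 * M₁ + k' * M₂ ^ 2, by positivity, ?_⟩
  intro D d ρ hD hd hρ hρ1 hgrow hlin
  set t := d + L + 1 with ht
  have ht1 : 1 ≤ t := by linarith
  have ht0 : 0 < t := by linarith
  have hp' : 0 ≤ 2 - p := by linarith
  have hDt : D ≤ (M₁ + M₂) * t := by
    have h1 : ρ ^ 2 ≤ 1 := by nlinarith
    have h2 : ρ * d ≤ d := by nlinarith
    nlinarith
  have hgt : d ^ 2 ≤ k * (t ^ (2 - p) * D) := by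
    refine hgrow.trans ?_
    have : d + L ≤ t := by linarith
    gcongr
  have htt : t ^ (2 - p) * t = t ^ (3 - p) := by
    rw [← Real.rpow_add_one ht0.ne']; congr 1; ring
  have hone : 1 ≤ t ^ (3 - p) := Real.one_le_rpow ht1 (by linarith)
  have hsq : t ^ 2 ≤ S * t ^ (3 - p) := by
    have h1 : k * (t ^ (2 - p) * D) ≤ k * (M₁ + M₂) * t ^ (3 - p) := by
      rw [← htt]
      calc k * (t ^ (2 - p) * D) ≤ k * (t ^ (2 - p) * ((M₁ + M₂) * t)) := by gcongr
        _ = _ := by ring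
    have h2 : t ^ 2 ≤ 2 * d ^ 2 + 2 * (L + 1) ^ 2 := by
      rw [ht]; nlinarith [sq_nonneg (d - (L + 1))]
    have h3 : 2 * (L + 1) ^ 2 ≤ 2 * (L + 1) ^ 2 * t ^ (3 - p) :=
      le_mul_of_one_le_right (by positivity) hone
    rw [hS]; linarith
  have htp : t ^ (p - 1) ≤ S := by
    have h1 : t ^ 2 = t ^ (p - 1) * t ^ (3 - p) := by
      rw [← Real.rpow_add ht0, ← Real.rpow_natCast]; congr 1; push_cast; ring
    rw [h1] at hsq
    exact le_of_mul_le_mul_right hsq (by positivity)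
  have htT : t ≤ T := by
    have h1 : t = (t ^ (p - 1)) ^ (1 / (p - 1)) := by
      rw [← Real.rpow_mul ht0.le, mul_one_div_cancel (by linarith), Real.rpow_one]
    rw [h1, hT]
    have : 0 ≤ 1 / (p - 1) := by
      have : 0 < p - 1 := by linarith
      positivity
    gcongr
  have hdk : d ^ 2 ≤ k' * D := by
    refine hgt.trans ?_
    rw [hk', mul_assoc]
    gcongr
  have hamgm : 2 * k' * (M₂ * ρ * d) ≤ d ^ 2 + (k' * M₂ * ρ) ^ 2 := by
    nlinarith [sq_nonneg (d - k' * M₂ * ρ)]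
  have hfin : k' * D ≤ k' * ((2 * M₁ + k' * M₂ ^ 2) * ρ ^ 2) := by nlinarith
  exact le_of_mul_le_mul_left hfin hk'0

/-- An approximate source condition yields, at each admissible scale, a source element with
controlled norm and residual. -/
lemma exists_source_element {Y E : Type*} [NormedAddCommGroup Y] [NormedAddCommGroup E]
    (S : Y → E) {q r C₀ β : ℝ} (hq : 0 < q) (hC₀ : 0 < C₀) (hβ : 0 < β)
    (h : (⨅ w : Y, (1 / β * ‖S w‖ ^ q + 1 / 2 * ‖w‖ ^ 2)) ≤ C₀ * β ^ (-r)) :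
    ∃ w : Y, ‖w‖ ^ 2 ≤ 4 * C₀ * β ^ (-r) ∧
      ‖S w‖ ≤ (2 * C₀) ^ (1 / q) * β ^ ((1 - r) / q) := by
  have hpos : 0 < C₀ * β ^ (-r) := by positivity
  obtain ⟨w, hw⟩ := exists_lt_of_ciInf_lt (h.trans_lt (by linarith : _ < 2 * (C₀ * β ^ (-r))))
  have h1 : 0 ≤ 1 / β * ‖S w‖ ^ q := by positivity
  have h2 : 0 ≤ 1 / 2 * ‖w‖ ^ 2 := by positivity
  refine ⟨w, by linarith, ?_⟩
  have h3 : ‖S w‖ ^ q ≤ 2 * C₀ * β ^ (1 - r) := by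
    have h4 : 1 / β * ‖S w‖ ^ q ≤ 2 * (C₀ * β ^ (-r)) := by linarith
    rw [div_mul_eq_mul_div, one_mul, div_le_iff₀ hβ] at h4
    have h5 : β ^ (1 - r) = β ^ (-r) * β := by
      rw [← Real.rpow_add_one hβ.ne']; congr 1; ring
    rw [h5]; linarith
  calc ‖S w‖ = (‖S w‖ ^ q) ^ (1 / q) := by
        rw [← Real.rpow_mul (norm_nonneg _), mul_one_div_cancel hq.ne', Real.rpow_one]
    _ ≤ (2 * C₀ * β ^ (1 - r)) ^ (1 / q) := by gcongr
    _ = (2 * C₀) ^ (1 / q) * β ^ ((1 - r) / q) := by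
        rw [Real.mul_rpow (by positivity) (by positivity), ← Real.rpow_mul hβ.le, mul_one_div]

/-- Testing the optimality condition with the error and splitting off source elements. -/
lemma bregman_le_of_optimality {X Y Z : Type*}
    [NormedAddCommGroup X] [NormedSpace ℝ X]
    [NormedAddCommGroup Y] [InnerProductSpace ℝ Y]
    [NormedAddCommGroup Z] [NormedSpace ℝ Z]
    (j : Z →L[ℝ] Y) (K : X →L[ℝ] Z) (n : Z →L[ℝ] ℝ) {u v : X} {μ ν : X →L[ℝ] ℝ} {δ a : ℝ}
    (hδ : 0 < δ) (ha : 0 < a)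
    (hopt : ∀ x : X, ⟪j (K x), j (K u) - j (K v)⟫ - δ * n (K x) + a * μ x = 0)
    (w₁ w₂ : Y) :
    a * (μ - ν) (u - v) ≤ 1 / 2 * a ^ 2 * ‖w₁‖ ^ 2 + 1 / 2 * δ ^ 2 * ‖w₂‖ ^ 2
      + (a * ‖(innerSL ℝ w₁).comp (j.comp K) - ν‖
        + δ * ‖(innerSL ℝ w₂).comp (j.comp K) - n.comp K‖) * ‖u - v‖ := by
  have h := hopt (u - v)
  have hy : j (K u) - j (K v) = j (K (u - v)) := by simp
  rw [hy, real_inner_self_eq_norm_sq] at h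
  set e := u - v
  set y := j (K e)
  have h1 : ⟪w₁, y⟫ = ((innerSL ℝ w₁).comp (j.comp K) - ν) e + ν e := by simp [y]
  have h2 : ⟪w₂, y⟫ = ((innerSL ℝ w₂).comp (j.comp K) - n.comp K) e + n (K e) := by simp [y]
  have b1 := (le_abs_self _).trans (((innerSL ℝ w₁).comp (j.comp K) - ν).le_opNorm e)
  have b2 := (neg_le_abs _).trans
    (((innerSL ℝ w₂).comp (j.comp K) - n.comp K).le_opNorm e)
  have i1 := (neg_le_abs _).trans (abs_real_inner_le_norm w₁ y)
  have i2 := (le_abs_self _).trans (abs_real_inner_le_norm w₂ y)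
  set R₁ := ‖(innerSL ℝ w₁).comp (j.comp K) - ν‖
  set R₂ := ‖(innerSL ℝ w₂).comp (j.comp K) - n.comp K‖
  rw [sub_apply]
  have c1 := mul_le_mul_of_nonneg_left b1 ha.le
  have c2 := mul_le_mul_of_nonneg_left b2 hδ.le
  have c3 := mul_le_mul_of_nonneg_left i1 ha.le
  have c4 := mul_le_mul_of_nonneg_left i2 hδ.le
  have s1 := sq_nonneg (a * ‖w₁‖ - ‖y‖)
  have s2 := sq_nonneg (δ * ‖w₂‖ - ‖y‖)
  have k1 : a * ⟪w₁, y⟫ = a * ((innerSL ℝ w₁).comp (j.comp K) - ν) e + a * ν e := by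
    rw [h1]; ring
  have k2 : δ * ⟪w₂, y⟫ = δ * ((innerSL ℝ w₂).comp (j.comp K) - n.comp K) e
      + δ * n (K e) := by rw [h2]; ring
  nlinarith

/-- The convergence rate `δ^(2θ)` for `α ≃ δ^κ`, where `θ` is the rate exponent of the
approximation error and the noise exponent dominates `θ`. -/
lemma exists_bregman_rate {X Y Z : Type*}
    [NormedAddCommGroup X] [NormedSpace ℝ X]
    [NormedAddCommGroup Y] [InnerProductSpace ℝ Y]
    [NormedAddCommGroup Z] [NormedSpace ℝ Z]
    (j : Z →L[ℝ] Y) (K : X →L[ℝ] Z) (udag : X) (n : Z →L[ℝ] ℝ)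
    {p q : ℝ} (hp1 : 1 < p) (hp2 : p < 2) (hq : 0 < q)
    {c2 : ℝ} (hc2 : 0 < c2)
    (hconvex : ∀ (u v : X) (j2 : X →L[ℝ] ℝ), j2 u = ‖u‖ * ‖j2‖ → ‖j2‖ = ‖u‖ →
      1 / 2 * ‖u‖ ^ 2 - j2 v + c2 / 2 * ‖v‖ ^ 2 ≤ 1 / 2 * ‖u - v‖ ^ 2)
    {μdag : X →L[ℝ] ℝ}
    (hμdag : ∀ v : X, 1 / p * ‖udag‖ ^ p + μdag (v - udag) ≤ 1 / p * ‖v‖ ^ p)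
    {r1 r2 C0 β0 : ℝ} (hC0 : 0 < C0) (hβ0 : 0 < β0)
    (hsc1 : ∀ β : ℝ, 0 < β → β ≤ β0 →
      (⨅ w : Y, (1 / β * ‖(innerSL ℝ w).comp (j.comp K) - μdag‖ ^ q + 1 / 2 * ‖w‖ ^ 2))
        ≤ C0 * β ^ (-r1))
    (hsc2 : ∀ β : ℝ, 0 < β → β ≤ β0 →
      (⨅ w : Y, (1 / β * ‖(innerSL ℝ w).comp (j.comp K) - n.comp K‖ ^ q + 1 / 2 * ‖w‖ ^ 2))
        ≤ C0 * β ^ (-r2))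
    {κ θ : ℝ} (hκ : 0 < κ) (hν1 : 0 < 2 + r1 * (q - 2)) (hν2 : 0 < 2 + r2 * (q - 2))
    (hθ0 : 0 ≤ θ) (hθ1 : θ = κ * (1 - r1) / (2 + r1 * (q - 2)))
    (hθ2 : θ ≤ 1 - κ + κ * (1 - r2) / (2 + r2 * (q - 2)))
    {α : ℝ → ℝ} {c C : ℝ} (hc : 0 < c) (hC : 0 < C)
    (hα : ∀ δ : ℝ, 0 < δ → c * δ ^ κ ≤ α δ ∧ α δ ≤ C * δ ^ κ)
    {uu : ℝ → X} {mm : ℝ → (X →L[ℝ] ℝ)}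
    (hsub : ∀ δ : ℝ, 0 < δ → ∀ v : X,
      (1 / p * ‖uu δ‖ ^ p) + (mm δ) (v - uu δ) ≤ 1 / p * ‖v‖ ^ p)
    (hopt : ∀ δ : ℝ, 0 < δ → ∀ u : X,
      ⟪j (K u), j (K (uu δ)) - j (K udag)⟫ - δ * n (K u) + α δ * (mm δ) u = 0) :
    ∃ Cp δ0 : ℝ, 0 < Cp ∧ 0 < δ0 ∧ ∀ δ : ℝ, 0 < δ → δ ≤ δ0 →
      (mm δ - μdag) (uu δ - udag) ≤ Cp * δ ^ (2 * θ) := by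
  set ν1 := 2 + r1 * (q - 2) with hν1def
  set ν2 := 2 + r2 * (q - 2) with hν2def
  set σ := 1 - κ + κ * (1 - r2) / ν2 with hσ
  set Q := (2 * C0) ^ (1 / q) with hQ
  have hQ0 : 0 < Q := by positivity
  obtain ⟨Cp, hCp, hbound⟩ := exists_bound_of_growth (p := p)
    (k := (2 * p - 1) / ((p - 1) * c2)) (L := ‖udag‖)
    (M₁ := 2 * C0 * C + 2 * C0 / c) (M₂ := Q + Q / c) hp1 hp2
    (div_pos (by linarith) (mul_pos (by linarith) hc2)) (norm_nonneg _)
    (by positivity) (by positivity)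
  have hsmall : ∀ s : ℝ, 0 < s → ∀ δ : ℝ, 0 < δ → δ ≤ β0 ^ (1 / s) → δ ^ s ≤ β0 := by
    intro s hs δ hδ h
    calc δ ^ s ≤ (β0 ^ (1 / s)) ^ s := by gcongr
      _ = β0 := by rw [← Real.rpow_mul hβ0.le, one_div_mul_cancel hs.ne', Real.rpow_one]
  have hs1 : 0 < κ * q / ν1 := by positivity
  have hs2 : 0 < κ * q / ν2 := by positivity
  refine ⟨Cp, min 1 (min (β0 ^ (1 / (κ * q / ν1))) (β0 ^ (1 / (κ * q / ν2)))), hCp,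
    by positivity, ?_⟩
  intro δ hδ hδ0
  obtain ⟨hδ1, hδ2⟩ := le_min_iff.mp hδ0
  obtain ⟨hδ2, hδ3⟩ := le_min_iff.mp hδ2
  have hD := bregman_nonneg (hsub δ hδ) hμdag
  have hgrow := sq_norm_sub_le_bregman hp1 hp2 hconvex (hsub δ hδ) hμdag
  obtain ⟨hαl, hαu⟩ := hα δ hδ
  have hα0 : 0 < α δ := lt_of_lt_of_le (by positivity) hαl
  obtain ⟨w₁, hw₁, hR₁⟩ := exists_source_element _ hq hC0 (by positivity)
    (hsc1 (δ ^ (κ * q / ν1)) (by positivity) (hsmall _ hs1 δ hδ hδ2))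
  obtain ⟨w₂, hw₂, hR₂⟩ := exists_source_element _ hq hC0 (by positivity)
    (hsc2 (δ ^ (κ * q / ν2)) (by positivity) (hsmall _ hs2 δ hδ hδ3))
  have hmain := bregman_le_of_optimality j K n (ν := μdag) hδ hα0 (hopt δ hδ) w₁ w₂
  rw [← Real.rpow_mul hδ.le] at hw₁ hR₁ hw₂ hR₂
  set R₁ := ‖(innerSL ℝ w₁).comp (j.comp K) - μdag‖
  set R₂ := ‖(innerSL ℝ w₂).comp (j.comp K) - n.comp K‖
  set D := (mm δ - μdag) (uu δ - udag)
  set d := ‖uu δ - udag‖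
  have hd0 : 0 ≤ d := norm_nonneg _
  set a := α δ
  have hρ0 : 0 < δ ^ θ := by positivity
  have hsq : δ ^ (2 * θ) = (δ ^ θ) ^ 2 := by
    rw [← Real.rpow_natCast, ← Real.rpow_mul hδ.le]; congr 1; push_cast; ring
  have hσθ : δ ^ σ ≤ δ ^ θ := Real.rpow_le_rpow_of_exponent_ge hδ hδ1 hθ2
  have hδa : δ / a ≤ 1 / c * δ ^ (1 - κ) := by
    rw [div_le_iff₀ hα0]
    calc δ = 1 / c * δ ^ (1 - κ) * (c * δ ^ κ) := by
          have : δ ^ (1 - κ) * δ ^ κ = δ := by rw [← Real.rpow_add hδ]; simp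
          field_simp; linarith
      _ ≤ _ := by gcongr
  have hR₁' : R₁ ≤ Q * δ ^ θ := by
    refine hR₁.trans_eq ?_
    congr 2; rw [hθ1]; field_simp
  have hR₂' : δ / a * R₂ ≤ Q / c * δ ^ θ := by
    calc δ / a * R₂ ≤ (1 / c * δ ^ (1 - κ)) * (Q * δ ^ (κ * q / ν2 * ((1 - r2) / q))) := by
          gcongr
      _ = Q / c * (δ ^ (1 - κ) * δ ^ (κ * q / ν2 * ((1 - r2) / q))) := by ring
      _ = Q / c * δ ^ σ := by
          rw [← Real.rpow_add hδ]; congr 2; rw [hσ]; field_simp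
      _ ≤ _ := by gcongr
  have hW₁ : 1 / 2 * a * ‖w₁‖ ^ 2 ≤ 2 * C0 * C * (δ ^ θ) ^ 2 := by
    calc 1 / 2 * a * ‖w₁‖ ^ 2
        ≤ 1 / 2 * (C * δ ^ κ) * (4 * C0 * δ ^ (κ * q / ν1 * -r1)) := by gcongr
      _ = 2 * C0 * C * (δ ^ κ * δ ^ (κ * q / ν1 * -r1)) := by ring
      _ = 2 * C0 * C * (δ ^ θ) ^ 2 := by
          rw [← Real.rpow_add hδ, ← hsq]; congr 2; rw [hθ1]; field_simp; rw [hν1def]; ring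
  have hW₂ : 1 / 2 * δ * (δ / a) * ‖w₂‖ ^ 2 ≤ 2 * C0 / c * (δ ^ θ) ^ 2 := by
    calc 1 / 2 * δ * (δ / a) * ‖w₂‖ ^ 2
        ≤ 1 / 2 * δ * (1 / c * δ ^ (1 - κ)) * (4 * C0 * δ ^ (κ * q / ν2 * -r2)) := by
          gcongr
      _ = 2 * C0 / c * (δ ^ (1 : ℝ) * δ ^ (1 - κ) * δ ^ (κ * q / ν2 * -r2)) := by
          rw [Real.rpow_one]; ring
      _ = 2 * C0 / c * (δ ^ σ) ^ 2 := by
          rw [← Real.rpow_add hδ, ← Real.rpow_add hδ, ← Real.rpow_natCast (δ ^ σ),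
            ← Real.rpow_mul hδ.le]
          congr 2; rw [hσ]; push_cast; field_simp; rw [hν2def]; ring
      _ ≤ _ := by gcongr
  have hlin : D ≤ (2 * C0 * C + 2 * C0 / c) * (δ ^ θ) ^ 2 + (Q + Q / c) * δ ^ θ * d := by
    have h1 : D ≤ 1 / 2 * a * ‖w₁‖ ^ 2 + 1 / 2 * δ * (δ / a) * ‖w₂‖ ^ 2
        + (R₁ + δ / a * R₂) * d := by
      refine le_of_mul_le_mul_left (hmain.trans_eq ?_) hα0
      field_simp
    have h2 : (R₁ + δ / a * R₂) * d ≤ (Q * δ ^ θ + Q / c * δ ^ θ) * d := by gcongr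
    linarith
  rw [hsq]
  refine hbound D d (δ ^ θ) hD hd0 hρ0 (Real.rpow_le_one hδ.le hδ1 hθ0) ?_ hlin
  have hpc : 0 < (p - 1) * c2 := mul_pos (by linarith) hc2
  rw [div_mul_eq_mul_div, le_div_iff₀ hpc]
  linarith

open scoped RealInnerProductSpace

/-- Theorem 3.7 (`p`-homogeneous regularization, `1 < p < 2`): if `X` is `p`-smooth and
`2`-convex, `R(u) = (1/p)‖u‖^p`, and the approximate source conditions of orders
`r1, r2 ≥ 0`, `r1 < 1` hold, then with `ν_i = 2 + r_i(q−2)`, `q = p/(p−1)`, and the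
choice `α(δ) ≃ δ^κ` (`κ = ν1ν2/(ν1ν2 + q(r2−r1))` if `r1 ≤ r2`, `κ = 1` if
`r2 < r1 < 1`), the symmetric Bregman distance decays as
`δ^{2ν2(1−r1)/(ν1ν2 + q(r2−r1))}` resp. `δ^{2(1−r1)/(2 + r1(q−2))}`. -/
theorem stmt11
    {X Y Z : Type*}
    [NormedAddCommGroup X] [NormedSpace ℝ X] [CompleteSpace X]
    [TopologicalSpace.SeparableSpace X]
    [NormedAddCommGroup Y] [InnerProductSpace ℝ Y] [CompleteSpace Y]
    [NormedAddCommGroup Z] [NormedSpace ℝ Z]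
    -- Gelfand triple: `Z` densely and injectively embedded in `Y` via `j`
    (j : Z →L[ℝ] Y) (hjinj : Function.Injective j) (hjdense : DenseRange j)
    (K : X →L[ℝ] Z)
    (udag : X) (n : Z →L[ℝ] ℝ)
    (p q : ℝ) (hp1 : 1 < p) (hp2 : p < 2) (hq : q = p / (p - 1))
    -- `X` is `p`-smooth
    (hsmooth : ∃ G : ℝ, 0 < G ∧ ∀ (u v : X) (jp : X →L[ℝ] ℝ),
      jp u = ‖u‖ * ‖jp‖ → ‖jp‖ = ‖u‖ ^ (p - 1) →
      1 / p * ‖u - v‖ ^ p ≤ 1 / p * ‖u‖ ^ p - jp v + G / p * ‖v‖ ^ p)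
    -- `X` is `2`-convex
    (hconvex2 : ∃ c2 : ℝ, 0 < c2 ∧ ∀ (u v : X) (j2 : X →L[ℝ] ℝ),
      j2 u = ‖u‖ * ‖j2‖ → ‖j2‖ = ‖u‖ →
      1 / 2 * ‖u‖ ^ 2 - j2 v + c2 / 2 * ‖v‖ ^ 2 ≤ 1 / 2 * ‖u - v‖ ^ 2)
    -- `μ† ∈ ∂R(u†)` for `R(u) = (1/p)‖u‖^p`
    (μdag : X →L[ℝ] ℝ)
    (hμdag : ∀ v : X, 1 / p * ‖udag‖ ^ p + μdag (v - udag) ≤ 1 / p * ‖v‖ ^ p)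
    (r1 r2 : ℝ) (hr1 : 0 ≤ r1) (hr2 : 0 ≤ r2) (hr1lt : r1 < 1)
    (C0 β0 : ℝ) (hC0 : 0 < C0) (hβ0 : 0 < β0)
    -- approximate source condition of order `r1` for the unknown
    (hsc1 : ∀ β : ℝ, 0 < β → β ≤ β0 →
      (⨅ w : Y, (1 / β * ‖(innerSL ℝ w).comp (j.comp K) - μdag‖ ^ q + 1 / 2 * ‖w‖ ^ 2))
        ≤ C0 * β ^ (-r1))
    -- approximate source condition of order `r2` for the noise `η = K*n`
    (hsc2 : ∀ β : ℝ, 0 < β → β ≤ β0 →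
      (⨅ w : Y, (1 / β * ‖(innerSL ℝ w).comp (j.comp K) - n.comp K‖ ^ q + 1 / 2 * ‖w‖ ^ 2))
        ≤ C0 * β ^ (-r2))
    -- a-priori parameter choice `α(δ) ≃ δ^κ`
    (κ : ℝ)
    (hκ : κ = if r1 ≤ r2 then
        (2 + r1 * (q - 2)) * (2 + r2 * (q - 2))
          / ((2 + r1 * (q - 2)) * (2 + r2 * (q - 2)) + q * (r2 - r1))
      else 1)
    (α : ℝ → ℝ) (c C : ℝ) (hc : 0 < c) (hC : 0 < C)
    (hα : ∀ δ : ℝ, 0 < δ → c * δ ^ κ ≤ α δ ∧ α δ ≤ C * δ ^ κ)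
    -- for each `δ`: a minimizer `u^δ_α` of `J^δ_α` with subgradient `μ^δ_α`
    -- satisfying the optimality condition
    (uu : ℝ → X) (mm : ℝ → (X →L[ℝ] ℝ))
    (hmin : ∀ δ : ℝ, 0 < δ → ∀ v : X,
      1 / 2 * ‖j (K (uu δ))‖ ^ 2 - (⟪j (K (uu δ)), j (K udag)⟫ + δ * n (K (uu δ)))
          + α δ * (1 / p * ‖uu δ‖ ^ p)
        ≤ 1 / 2 * ‖j (K v)‖ ^ 2 - (⟪j (K v), j (K udag)⟫ + δ * n (K v))
          + α δ * (1 / p * ‖v‖ ^ p))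
    (hsub : ∀ δ : ℝ, 0 < δ → ∀ v : X,
      (1 / p * ‖uu δ‖ ^ p) + (mm δ) (v - uu δ) ≤ 1 / p * ‖v‖ ^ p)
    (hopt : ∀ δ : ℝ, 0 < δ → ∀ u : X,
      ⟪j (K u), j (K (uu δ)) - j (K udag)⟫ - δ * n (K u) + α δ * (mm δ) u = 0)
 :
    ∃ Cp δ0 : ℝ, 0 < Cp ∧ 0 < δ0 ∧ ∀ δ : ℝ, 0 < δ → δ ≤ δ0 →
      (r1 ≤ r2 →
        (mm δ - μdag) (uu δ - udag)
          ≤ Cp * δ ^ (2 * (2 + r2 * (q - 2)) * (1 - r1)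
              / ((2 + r1 * (q - 2)) * (2 + r2 * (q - 2)) + q * (r2 - r1)))) ∧
      (r2 < r1 →
        (mm δ - μdag) (uu δ - udag)
          ≤ Cp * δ ^ (2 * (1 - r1) / (2 + r1 * (q - 2)))) := by
  obtain ⟨c2, hc2, hconvex⟩ := hconvex2
  have hp0 : 0 < p - 1 := by linarith
  have hq2 : 0 < q - 2 := by
    rw [hq, sub_pos, lt_div_iff₀ hp0]; linarith
  have hν1 : 0 < 2 + r1 * (q - 2) := by positivity
  have hν2 : 0 < 2 + r2 * (q - 2) := by positivity
  have h1r : 0 ≤ 1 - r1 := by linarith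
  rcases le_or_gt r1 r2 with h | h
  · rw [if_pos h] at hκ
    have hr : 0 ≤ r2 - r1 := by linarith
    have hq0 : 0 < q := by linarith
    have hden : 0 < (2 + r1 * (q - 2)) * (2 + r2 * (q - 2)) + q * (r2 - r1) := by positivity
    have hκ0 : 0 < κ := by rw [hκ]; positivity
    have hθ : 1 - κ + κ * (1 - r2) / (2 + r2 * (q - 2))
        = κ * (1 - r1) / (2 + r1 * (q - 2)) := by
      rw [hκ]; field_simp; ring
    obtain ⟨Cp, δ0, hCp, hδ0, hrate⟩ := exists_bregman_rate j K udag n hp1 hp2 hq0 hc2 hconvex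
      hμdag hC0 hβ0 hsc1 hsc2 hκ0 hν1 hν2 (by positivity) rfl hθ.ge hc hC hα hsub hopt
    refine ⟨Cp, δ0, hCp, hδ0, fun δ hδ hδδ => ⟨fun _ => ?_, fun h' => absurd h h'.not_ge⟩⟩
    convert hrate δ hδ hδδ using 3
    rw [hκ]; field_simp
  · rw [if_neg h.not_ge] at hκ
    subst hκ
    have hθ : 1 * (1 - r1) / (2 + r1 * (q - 2))
        ≤ 1 - 1 + 1 * (1 - r2) / (2 + r2 * (q - 2)) := by
      rw [sub_self, zero_add, one_mul, one_mul, div_le_div_iff₀ hν1 hν2]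
      nlinarith
    obtain ⟨Cp, δ0, hCp, hδ0, hrate⟩ := exists_bregman_rate j K udag n hp1 hp2
      (by linarith) hc2 hconvex
      hμdag hC0 hβ0 hsc1 hsc2 one_pos hν1 hν2 (by positivity) rfl hθ hc hC hα hsub hopt
    refine ⟨Cp, δ0, hCp, hδ0, fun δ hδ hδδ => ⟨fun h' => absurd h h'.not_gt, fun _ => ?_⟩⟩
    convert hrate δ hδ hδδ using 3
    rw [one_mul, mul_div_assoc]
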